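/- A weighted system (𝒜, α) is asymptotically stable — i.e., for every sequence (A(k))_{k≥1} with each A(k) ∈ 𝒜 and every x ∈ ℝ^d, the trajectory A(k)⋯A(1)x tends to 0 as k → ∞ — if and only if ρ(𝒜, α) < 1. -/

import Mathlib

open Filter

attribute [local instance] Matrix.linftyOpNormedRing

/-- The product `A(k)⋯A(1)` associated with the word `w = (i_1, …, i_k)`. -/
noncomputable def wordProd {d m : ℕ} (A : Fin m → Matrix (Fin d) (Fin d) ℝ)
    (w : List (Fin m)) : Matrix (Fin d) (Fin d) ℝ :=
  ((w.map A).reverse).prod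

/-- The total weight `α(k)+⋯+α(1)` of the word `w = (i_1, …, i_k)`. -/
def wordWeight {m : ℕ} (α : Fin m → ℝ) (w : List (Fin m)) : ℝ :=
  (w.map α).sum

/-- `ρ_k`: the maximum of `‖A(k)⋯A(1)‖^(1/(α(k)+⋯+α(1)))` over products of length `k`. -/
noncomputable def rhoSeq {d m : ℕ} (A : Fin m → Matrix (Fin d) (Fin d) ℝ)
    (α : Fin m → ℝ) (k : ℕ) : ℝ :=
  sSup {r : ℝ | ∃ w : List (Fin m), w.length = k ∧
    r = ‖wordProd A w‖ ^ (1 / wordWeight α w)}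

/-- The `α`-weighted joint spectral radius `ρ(𝒜, α) = limsup_{k→∞} ρ_k`. -/
noncomputable def wjsr {d m : ℕ} (A : Fin m → Matrix (Fin d) (Fin d) ℝ)
    (α : Fin m → ℝ) : ℝ :=
  limsup (rhoSeq A α) atTop

theorem wordProd_append {d m : ℕ} (A : Fin m → Matrix (Fin d) (Fin d) ℝ) (v w : List (Fin m)) :
    wordProd A (v ++ w) = wordProd A w * wordProd A v := by
  simp [wordProd]

theorem norm_wordProd_le {d m : ℕ} (A : Fin m → Matrix (Fin d) (Fin d) ℝ) :
    ∃ M : ℝ, 1 ≤ M ∧ ∀ w, ‖wordProd A w‖ ≤ M ^ w.length := by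
  have hsum : 0 ≤ ∑ i, ‖A i‖ := Finset.sum_nonneg fun i _ => norm_nonneg _
  refine ⟨1 + ∑ i, ‖A i‖, by linarith, fun w => ?_⟩
  induction w with
  | nil =>
    rcases isEmpty_or_nonempty (Fin d) with h | h
    · rw [Subsingleton.elim (wordProd A []) 0]
      simp
    · simp [wordProd]
  | cons i w ih =>
    have h1 : wordProd A (i :: w) = wordProd A w * A i := by simp [wordProd]
    have h2 : ‖A i‖ ≤ 1 + ∑ i, ‖A i‖ := by
      have := Finset.single_le_sum (f := fun i => ‖A i‖) (fun i _ => norm_nonneg _)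
        (Finset.mem_univ i)
      linarith
    rw [h1, List.length_cons, pow_succ]
    refine (norm_mul_le _ _).trans ?_
    gcongr

theorem length_mul_le_wordWeight {m : ℕ} {α : Fin m → ℝ} {a : ℝ} (h : ∀ i, a ≤ α i)
    (w : List (Fin m)) : w.length * a ≤ wordWeight α w := by
  induction w with
  | nil => simp [wordWeight]
  | cons i w ih =>
    have := h i
    simp only [wordWeight, List.map_cons, List.sum_cons, List.length_cons] at *
    push_cast
    linarith

theorem wordWeight_le_length_mul {m : ℕ} {α : Fin m → ℝ} {b : ℝ} (h : ∀ i, α i ≤ b)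
    (w : List (Fin m)) : wordWeight α w ≤ w.length * b := by
  induction w with
  | nil => simp [wordWeight]
  | cons i w ih =>
    have := h i
    simp only [wordWeight, List.map_cons, List.sum_cons, List.length_cons] at *
    push_cast
    linarith

theorem rhoSeq_nonneg {d m : ℕ} (A : Fin m → Matrix (Fin d) (Fin d) ℝ) (α : Fin m → ℝ) (k : ℕ) :
    0 ≤ rhoSeq A α k := by
  refine Real.sSup_nonneg ?_
  rintro _ ⟨w, -, rfl⟩
  positivity

theorem le_rhoSeq {d m : ℕ} (A : Fin m → Matrix (Fin d) (Fin d) ℝ) (α : Fin m → ℝ)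
    (w : List (Fin m)) :
    ‖wordProd A w‖ ^ (1 / wordWeight α w) ≤ rhoSeq A α w.length := by
  refine le_csSup ?_ ⟨w, rfl, rfl⟩
  refine (((List.finite_length_eq (Fin m) w.length).image
    fun w => ‖wordProd A w‖ ^ (1 / wordWeight α w)).subset ?_).bddAbove
  rintro _ ⟨v, hv, rfl⟩
  exact ⟨v, hv, rfl⟩

theorem rhoSeq_le {d m : ℕ} (A : Fin m → Matrix (Fin d) (Fin d) ℝ) (α : Fin m → ℝ) {k : ℕ} {c : ℝ}
    (hc : 0 ≤ c)
    (h : ∀ w : List (Fin m), w.length = k → ‖wordProd A w‖ ^ (1 / wordWeight α w) ≤ c) :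
    rhoSeq A α k ≤ c := by
  refine Real.sSup_le ?_ hc
  rintro _ ⟨w, hw, rfl⟩
  exact h w hw

theorem isBoundedUnder_rhoSeq {d m : ℕ} (A : Fin m → Matrix (Fin d) (Fin d) ℝ) {α : Fin m → ℝ}
    {a : ℝ} (ha : 0 < a) (h : ∀ i, a ≤ α i) :
    IsBoundedUnder (· ≤ ·) atTop (rhoSeq A α) := by
  obtain ⟨M, hM, hA⟩ := norm_wordProd_le A
  refine isBoundedUnder_of_eventually_le (a := M ^ (1 / a)) ?_
  filter_upwards [eventually_gt_atTop 0] with k hk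
  refine rhoSeq_le A α (by positivity) fun w hw => ?_
  have hk' : (0 : ℝ) < k := by exact_mod_cast hk
  have hweight : k * a ≤ wordWeight α w := hw ▸ length_mul_le_wordWeight h w
  have hpos : 0 < wordWeight α w := lt_of_lt_of_le (by positivity) hweight
  calc ‖wordProd A w‖ ^ (1 / wordWeight α w) ≤ (M ^ k) ^ (1 / wordWeight α w) :=
        Real.rpow_le_rpow (norm_nonneg _) (hw ▸ hA w) (by positivity)
    _ = M ^ (k * (1 / wordWeight α w)) := by
        rw [← Real.rpow_natCast, ← Real.rpow_mul (by linarith)]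
    _ ≤ M ^ (1 / a) := by
        refine Real.rpow_le_rpow_of_exponent_le hM ?_
        rw [mul_one_div, div_le_div_iff₀ hpos ha]
        linarith

/-- If the weighted joint spectral radius is less than one, then long products are uniformly
small. -/
theorem eventually_norm_wordProd_le_of_wjsr_lt_one {d m : ℕ}
    (A : Fin m → Matrix (Fin d) (Fin d) ℝ) {α : Fin m → ℝ} {a : ℝ} (ha : 0 < a)
    (h : ∀ i, a ≤ α i) (hA : wjsr A α < 1) :
    ∃ r : ℝ, 0 < r ∧ r < 1 ∧
      ∀ᶠ k in atTop, ∀ w : List (Fin m), w.length = k → ‖wordProd A w‖ ≤ r ^ k := by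
  obtain ⟨r, hr, hr1⟩ := exists_between (max_lt hA one_pos)
  have hr0 : 0 < r := (le_max_right _ _).trans_lt hr
  refine ⟨r ^ a, by positivity, Real.rpow_lt_one hr0.le hr1 ha, ?_⟩
  filter_upwards [eventually_gt_atTop 0, eventually_lt_of_limsup_lt
    ((le_max_left _ _).trans_lt hr) (isBoundedUnder_rhoSeq A ha h)] with k hk hρ w hw
  have hk' : (0 : ℝ) < k := by exact_mod_cast hk
  have hweight : k * a ≤ wordWeight α w := hw ▸ length_mul_le_wordWeight h w
  have hpos : 0 < wordWeight α w := lt_of_lt_of_le (by positivity) hweight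
  have hle : ‖wordProd A w‖ ^ (1 / wordWeight α w) ≤ r :=
    (le_rhoSeq A α w).trans (hw ▸ hρ.le)
  rw [one_div, Real.rpow_inv_le_iff_of_pos (norm_nonneg _) hr0.le hpos] at hle
  refine hle.trans ?_
  rw [← Real.rpow_natCast, ← Real.rpow_mul hr0.le, mul_comm]
  exact Real.rpow_le_rpow_of_exponent_ge hr0 hr1.le hweight

theorem tendsto_matrix_zero_of_tendsto_mulVec {d : ℕ} {B : ℕ → Matrix (Fin d) (Fin d) ℝ}
    (h : ∀ x : Fin d → ℝ, Tendsto (fun k => (B k).mulVec x) atTop (nhds 0)) :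
    Tendsto B atTop (nhds 0) := by
  refine tendsto_pi_nhds.2 fun i => tendsto_pi_nhds.2 fun j => ?_
  have := tendsto_pi_nhds.1 (h (Pi.single j 1)) i
  simpa using this

/-- By compactness of the space of switching sequences, if every sequence of products tends to
zero then every sequence has an initial word of uniformly bounded length with small product. -/
theorem exists_uniform_contracting_initial_word {d m : ℕ} {A : Fin m → Matrix (Fin d) (Fin d) ℝ}
    (h : ∀ u : ℕ → Fin m,
      Tendsto (fun k => wordProd A (List.ofFn fun j : Fin k => u j)) atTop (nhds 0)) :
    ∃ N : ℕ, ∀ u : ℕ → Fin m, ∃ n : ℕ, 0 < n ∧ n ≤ N ∧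
      ‖wordProd A (List.ofFn fun j : Fin n => u j)‖ < 1 / 2 := by
  let U : ℕ → Set (ℕ → Fin m) := fun n =>
    {u | ‖wordProd A (List.ofFn fun j : Fin (n + 1) => u j)‖ < 1 / 2}
  have hopen : ∀ n, IsOpen (U n) := fun n => by
    have hcont : Continuous fun (u : ℕ → Fin m) (j : Fin (n + 1)) => u j := by fun_prop
    exact (isOpen_discrete {v | ‖wordProd A (List.ofFn v)‖ < 1 / 2}).preimage hcont
  have hcover : Set.univ ⊆ ⋃ n, U n := fun u _ => by
    have hnorm := (tendsto_zero_iff_norm_tendsto_zero.1 (h u)).eventually_lt_const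
      (show (0 : ℝ) < 1 / 2 by norm_num)
    obtain ⟨n, hn⟩ := ((tendsto_add_atTop_nat 1).eventually hnorm).exists
    exact Set.mem_iUnion.2 ⟨n, hn⟩
  obtain ⟨t, ht⟩ := isCompact_univ.elim_finite_subcover U hopen hcover
  refine ⟨t.sup id + 1, fun u => ?_⟩
  obtain ⟨n, hnt, hn⟩ := Set.mem_iUnion₂.1 (ht (Set.mem_univ u))
  exact ⟨n + 1, n.succ_pos, Nat.succ_le_succ (Finset.le_sup (f := id) hnt), hn⟩

theorem exists_norm_wordProd_le_geometric {d m : ℕ} (hm : 0 < m)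
    {A : Fin m → Matrix (Fin d) (Fin d) ℝ}
    (h : ∀ u : ℕ → Fin m,
      Tendsto (fun k => wordProd A (List.ofFn fun j : Fin k => u j)) atTop (nhds 0)) :
    ∃ C q : ℝ, 0 < q ∧ q < 1 ∧ ∀ w, ‖wordProd A w‖ ≤ C * q ^ w.length := by
  obtain ⟨N, hN⟩ := exists_uniform_contracting_initial_word h
  obtain ⟨M, hM, hA⟩ := norm_wordProd_le A
  obtain ⟨n₀, hn₀, hn₀N, -⟩ := hN fun _ => ⟨0, hm⟩
  have hNpos : N ≠ 0 := by omega
  obtain ⟨q, hq0, hq1, hqN⟩ : ∃ q : ℝ, 0 < q ∧ q < 1 ∧ q ^ N = 1 / 2 :=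
    ⟨(1 / 2) ^ (N⁻¹ : ℝ), by positivity,
      Real.rpow_lt_one (by norm_num) (by norm_num) (by positivity),
      Real.rpow_inv_natCast_pow (by norm_num) hNpos⟩
  refine ⟨M ^ N * 2, q, hq0, hq1, fun w => ?_⟩
  induction hl : w.length using Nat.strong_induction_on generalizing w with
  | _ l ih =>
    rcases lt_or_ge l N with hlN | hlN
    · have hq : 1 / 2 ≤ q ^ l := hqN ▸ pow_le_pow_of_le_one hq0.le hq1.le hlN.le
      calc ‖wordProd A w‖ ≤ M ^ l := hl ▸ hA w
        _ ≤ M ^ N := pow_le_pow_right₀ hM hlN.le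
        _ = M ^ N * 2 * (1 / 2) := by ring
        _ ≤ M ^ N * 2 * q ^ l := by gcongr
    · obtain ⟨n, hn0, hnN, hn⟩ := hN fun j => w.getD j ⟨0, hm⟩
      have htake : (List.ofFn fun j : Fin n => w.getD j ⟨0, hm⟩) = w.take n := by
        refine List.ext_getElem (by simp; omega) fun i h1 h2 => ?_
        simp only [List.length_ofFn] at h1
        have : i < w.length := by omega
        simp [this]
      rw [htake] at hn
      have hdrop := ih (l - n) (by omega) (w.drop n) (by simp [hl])
      have hq : 1 / 2 ≤ q ^ n := hqN ▸ pow_le_pow_of_le_one hq0.le hq1.le hnN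
      calc ‖wordProd A w‖ = ‖wordProd A (w.drop n) * wordProd A (w.take n)‖ := by
            rw [← wordProd_append, List.take_append_drop]
        _ ≤ ‖wordProd A (w.drop n)‖ * ‖wordProd A (w.take n)‖ := norm_mul_le _ _
        _ ≤ M ^ N * 2 * q ^ (l - n) * q ^ n := by
            gcongr
            exact hn.le.trans hq
        _ = M ^ N * 2 * q ^ l := by
            rw [mul_assoc, ← pow_add, Nat.sub_add_cancel (by omega)]

theorem wjsr_lt_one_of_norm_wordProd_le_geometric {d m : ℕ}
    {A : Fin m → Matrix (Fin d) (Fin d) ℝ} {α : Fin m → ℝ} {a b : ℝ} (ha : 0 < a) (hb : 0 < b)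
    (hαa : ∀ i, a ≤ α i) (hαb : ∀ i, α i ≤ b) {C q : ℝ} (hq0 : 0 < q) (hq1 : q < 1)
    (h : ∀ w, ‖wordProd A w‖ ≤ C * q ^ w.length) : wjsr A α < 1 := by
  obtain ⟨s, hqs, hs1⟩ := exists_between hq1
  have hs0 : 0 < s := hq0.trans hqs
  have hlim : Tendsto (fun k : ℕ => C * (q / s) ^ k) atTop (nhds 0) := by
    simpa using (tendsto_pow_atTop_nhds_zero_of_lt_one (by positivity)
      ((div_lt_one hs0).2 hqs)).const_mul C
  refine lt_of_le_of_lt (limsup_le_of_le (a := s ^ (1 / b)) ?_ ?_)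
    (Real.rpow_lt_one hs0.le hs1 (by positivity))
  · exact IsBoundedUnder.isCoboundedUnder_le
      (isBoundedUnder_of ⟨0, fun k => rhoSeq_nonneg A α k⟩)
  filter_upwards [eventually_gt_atTop 0, hlim.eventually_lt_const one_pos] with k hk hCk
  refine rhoSeq_le A α (by positivity) fun w hw => ?_
  have hk' : (0 : ℝ) < k := by exact_mod_cast hk
  have hpos : 0 < wordWeight α w :=
    lt_of_lt_of_le (by positivity) (hw ▸ length_mul_le_wordWeight hαa w : k * a ≤ _)
  have hweight : wordWeight α w ≤ k * b := hw ▸ wordWeight_le_length_mul hαb w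
  have hnorm : ‖wordProd A w‖ ≤ s ^ k := by
    refine (h w).trans ?_
    rw [div_pow, ← mul_div_assoc, div_lt_one (by positivity)] at hCk
    exact hw ▸ hCk.le
  calc ‖wordProd A w‖ ^ (1 / wordWeight α w) ≤ (s ^ k) ^ (1 / wordWeight α w) :=
        Real.rpow_le_rpow (norm_nonneg _) hnorm (by positivity)
    _ = s ^ (k * (1 / wordWeight α w)) := by
        rw [← Real.rpow_natCast, ← Real.rpow_mul hs0.le]
    _ ≤ s ^ (1 / b) := by
        refine Real.rpow_le_rpow_of_exponent_ge hs0 hs1.le ?_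
        rw [mul_one_div, div_le_div_iff₀ hb hpos]
        linarith

/-- A weighted system `(𝒜, α)` is asymptotically stable — every trajectory
`A(k)⋯A(1)x` tends to `0` — if and only if `ρ(𝒜, α) < 1`. -/
theorem asymptotically_stable_iff_wjsr_lt_one {d m : ℕ} (hm : 0 < m)
    (A : Fin m → Matrix (Fin d) (Fin d) ℝ)
    (α : Fin m → ℝ) (hα : ∀ i, 0 < α i) :
    (∀ u : ℕ → Fin m, ∀ x : Fin d → ℝ,
      Filter.Tendsto
        (fun k => (wordProd A (List.ofFn fun j : Fin k => u j)).mulVec x)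
        Filter.atTop (nhds 0)) ↔
    wjsr A α < 1 := by
  have : Nonempty (Fin m) := ⟨⟨0, hm⟩⟩
  obtain ⟨i₀, hi₀⟩ := Finite.exists_min α
  obtain ⟨i₁, hi₁⟩ := Finite.exists_max α
  constructor
  · intro h
    obtain ⟨C, q, hq0, hq1, hw⟩ := exists_norm_wordProd_le_geometric hm
      fun u => tendsto_matrix_zero_of_tendsto_mulVec (h u)
    exact wjsr_lt_one_of_norm_wordProd_le_geometric (hα i₀) (hα i₁) hi₀ hi₁ hq0 hq1 hw
  · intro h u x
    obtain ⟨r, hr0, hr1, hr⟩ := eventually_norm_wordProd_le_of_wjsr_lt_one A (hα i₀) hi₀ h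
    have hprod : Tendsto (fun k => wordProd A (List.ofFn fun j : Fin k => u j)) atTop (nhds 0) :=
      squeeze_zero_norm' (hr.mono fun k hk => hk _ (by simp))
        (tendsto_pow_atTop_nhds_zero_of_lt_one hr0.le hr1)
    have hcont : Continuous fun B : Matrix (Fin d) (Fin d) ℝ => B.mulVec x := by fun_prop
    simpa [Function.comp_def] using (hcont.tendsto 0).comp hprod
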